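/- arXiv:1408.1202 — 3 statements merged into one kernel-verified Lean document; each statement's English description precedes it below -/
import Mathlib

section
/- Let x ∈ 2^ω have infinitely many coordinates equal to 0 and infinitely many coordinates equal to 1. Then the E₀-class [x]_{E₀}, ordered by ≤₀, is order-isomorphic to the integers (ℤ, ≤). -/
/-- The equivalence relation `E₀` on the Cantor space `2^ω`:
`x E₀ y` iff `x n = y n` for all but finitely many `n`. -/
def E0 (x y : ℕ → Fin 2) : Prop := {n | x n ≠ y n}.Finite

/-- The partial quasi-order `≤₀` on `2^ω`: `x ≤₀ y` iff `x E₀ y` and either `x = y`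
or `x k < y k`, where `k` is the largest number with `x k ≠ y k`. -/
def Le0 (x y : ℕ → Fin 2) : Prop :=
  E0 x y ∧ (x = y ∨ ∃ k, (∀ n, k < n → x n = y n) ∧ x k < y k)

/-- The number whose binary digits are the first `N` entries of `x`. -/
def binaryValue (N : ℕ) (x : ℕ → Fin 2) : ℤ := ∑ n ∈ Finset.range N, ((x n : ℕ) : ℤ) * 2 ^ n

lemma binaryValue_succ (N : ℕ) (x : ℕ → Fin 2) :
    binaryValue (N + 1) x = binaryValue N x + ((x N : ℕ) : ℤ) * 2 ^ N :=
  Finset.sum_range_succ _ _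

lemma binaryValue_nonneg (N : ℕ) (x : ℕ → Fin 2) : 0 ≤ binaryValue N x :=
  Finset.sum_nonneg fun _ _ => by positivity

lemma binaryValue_mono (x : ℕ → Fin 2) : Monotone fun N => binaryValue N x :=
  monotone_nat_of_le_succ fun N => by
    rw [binaryValue_succ]
    exact le_add_of_nonneg_right (by positivity)

lemma binaryValue_add_binaryValue_rev (N : ℕ) (x : ℕ → Fin 2) :
    binaryValue N x + binaryValue N (fun n => (x n).rev) = 2 ^ N - 1 := by
  induction N with
  | zero => simp [binaryValue]
  | succ N ih =>
    rw [binaryValue_succ, binaryValue_succ, pow_succ]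
    obtain h | h : x N = 0 ∨ x N = 1 := by omega
    all_goals
      have hr : (0 : Fin 2).rev = 1 ∧ (1 : Fin 2).rev = 0 := by decide
      simp [h, hr]
      linarith

lemma binaryValue_lt (N : ℕ) (x : ℕ → Fin 2) : binaryValue N x < 2 ^ N := by
  have h := binaryValue_add_binaryValue_rev N x
  have h' := binaryValue_nonneg N fun n => (x n).rev
  linarith

lemma binaryValue_sub_binaryValue {N M : ℕ} (hNM : N ≤ M) {x y : ℕ → Fin 2}
    (h : ∀ n, N ≤ n → x n = y n) :
    binaryValue M x - binaryValue M y = binaryValue N x - binaryValue N y := by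
  induction M, hNM using Nat.le_induction with
  | base => rfl
  | succ M hM ih =>
    rw [binaryValue_succ, binaryValue_succ, h M hM]
    linarith

lemma exists_binaryValue_eq (N : ℕ) (x : ℕ → Fin 2) (w : ℤ) (hw : 0 ≤ w) (hw' : w < 2 ^ N) :
    ∃ y : ℕ → Fin 2, (∀ n, N ≤ n → y n = x n) ∧ binaryValue N y = w := by
  induction N generalizing x w with
  | zero => exact ⟨x, fun _ _ => rfl, by simp [binaryValue] at hw' ⊢; omega⟩
  | succ N ih =>
    rw [pow_succ] at hw'
    obtain ⟨b, hb, hb'⟩ : ∃ b : Fin 2, 0 ≤ w - ((b : ℕ) : ℤ) * 2 ^ N ∧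
        w - ((b : ℕ) : ℤ) * 2 ^ N < 2 ^ N := by
      rcases lt_or_ge w (2 ^ N) with h | h
      · exact ⟨0, by simpa using hw, by simpa using h⟩
      · exact ⟨1, by simpa using h, by simp; linarith⟩
    obtain ⟨y, hy, hv⟩ := ih (Function.update x N b) _ hb hb'
    refine ⟨y, fun n hn => ?_, ?_⟩
    · rw [hy n (by omega), Function.update_of_ne (by omega)]
    · rw [binaryValue_succ, hv, hy N le_rfl, Function.update_self]
      ring

lemma exists_le_binaryValue {x : ℕ → Fin 2} (h : {n | x n = 1}.Infinite) (B : ℕ) :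
    ∃ N, (B : ℤ) ≤ binaryValue N x := by
  induction B with
  | zero => exact ⟨0, by simp [binaryValue]⟩
  | succ B ih =>
    obtain ⟨N, hN⟩ := ih
    obtain ⟨n, hn, hNn⟩ := h.exists_gt N
    refine ⟨n + 1, ?_⟩
    have h1 : binaryValue N x ≤ binaryValue n x := binaryValue_mono x hNn.le
    have h2 : (1 : ℤ) ≤ 2 ^ n := one_le_pow₀ (by norm_num)
    have h3 : x n = 1 := hn
    rw [binaryValue_succ, h3]
    push_cast
    simp
    linarith

lemma binaryValue_trichotomy {N : ℕ} {y z : ℕ → Fin 2} (h : ∀ n, N ≤ n → y n = z n) :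
    y = z ∨
    ((∃ k, (∀ n, k < n → y n = z n) ∧ y k < z k) ∧ binaryValue N y < binaryValue N z) ∨
    ((∃ k, (∀ n, k < n → z n = y n) ∧ z k < y k) ∧ binaryValue N z < binaryValue N y) := by
  have lt_of_lt : ∀ {N : ℕ} {y z : ℕ → Fin 2}, y N < z N →
      binaryValue (N + 1) y < binaryValue (N + 1) z := by
    intro N y z hyz
    have hy : y N = 0 := by omega
    have hz : z N = 1 := by omega
    have := binaryValue_lt N y
    have := binaryValue_nonneg N z
    rw [binaryValue_succ, binaryValue_succ, hy, hz]
    simp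
    linarith
  induction N with
  | zero => exact Or.inl (funext fun n => h n n.zero_le)
  | succ N ih =>
    rcases lt_trichotomy (y N) (z N) with hN | hN | hN
    · exact Or.inr (Or.inl ⟨⟨N, fun n hn => h n hn, hN⟩, lt_of_lt hN⟩)
    · have := ih fun n hn => by
        rcases hn.eq_or_lt with rfl | hn
        exacts [hN, h n hn]
      simpa only [binaryValue_succ, hN, add_lt_add_iff_right] using this
    · exact Or.inr (Or.inr ⟨⟨N, fun n hn => (h n hn).symm, hN⟩, lt_of_lt hN⟩)

lemma le0_iff_binaryValue_le {N : ℕ} {y z : ℕ → Fin 2} (h : ∀ n, N ≤ n → y n = z n) :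
    Le0 y z ↔ binaryValue N y ≤ binaryValue N z := by
  have hE : E0 y z := (Set.finite_lt_nat N).subset fun n hn => by
    by_contra hn'
    exact hn (h n (not_lt.1 hn'))
  rcases binaryValue_trichotomy h with rfl | ⟨hk, hv⟩ | ⟨⟨k, hk, hlt⟩, hv⟩
  · exact iff_of_true ⟨hE, Or.inl rfl⟩ le_rfl
  · exact iff_of_true ⟨hE, Or.inr hk⟩ hv.le
  · refine iff_of_false ?_ hv.not_ge
    rintro ⟨-, rfl | ⟨l, hl, hlt'⟩⟩
    · exact hlt.false
    · rcases lt_trichotomy k l with hkl | rfl | hkl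
      · exact hlt'.ne (hk l hkl).symm
      · exact hlt.asymm hlt'
      · exact hlt.ne (hl k hkl).symm

lemma e0_iff_exists_forall_ge {x y : ℕ → Fin 2} :
    E0 x y ↔ ∃ N, ∀ n, N ≤ n → y n = x n := by
  constructor
  · intro h
    obtain ⟨N, hN⟩ := h.bddAbove
    refine ⟨N + 1, fun n hn => ?_⟩
    by_contra hne
    have : n ≤ N := hN (Ne.symm hne)
    omega
  · rintro ⟨N, hN⟩
    refine (Set.finite_lt_nat N).subset fun n hn => ?_
    by_contra hn'
    exact hn (hN n (not_lt.1 hn')).symm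

lemma exists_binaryValue_sub_eq {x : ℕ → Fin 2}
    (h0 : {n | x n = 0}.Infinite) (h1 : {n | x n = 1}.Infinite) (m : ℤ) :
    ∃ y : ℕ → Fin 2, ∃ N, (∀ n, N ≤ n → y n = x n) ∧
      binaryValue N y - binaryValue N x = m := by
  have h0' : {n | (x n).rev = 1}.Infinite := by
    simp only [Fin.rev_eq_iff]
    exact h0
  obtain ⟨N₁, hN₁⟩ := exists_le_binaryValue h1 m.natAbs
  obtain ⟨N₀, hN₀⟩ := exists_le_binaryValue h0' m.natAbs
  have le₁ := hN₁.trans (binaryValue_mono x (le_max_left N₁ N₀))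
  have le₀ := hN₀.trans (binaryValue_mono (fun n => (x n).rev) (le_max_right N₁ N₀))
  have hsum := binaryValue_add_binaryValue_rev (max N₁ N₀) x
  dsimp only at le₁ le₀
  obtain ⟨y, hy, hv⟩ := exists_binaryValue_eq (max N₁ N₀) x
    (binaryValue (max N₁ N₀) x + m) (by omega) (by omega)
  exact ⟨y, _, hy, by omega⟩

/-- If `x ∈ 2^ω` has infinitely many coordinates equal to `0` and infinitely many equal
to `1`, then the `E₀`-class `[x]_{E₀}`, ordered by `≤₀`, is order-isomorphic to `(ℤ, ≤)`. -/
theorem e0Class_orderIso_int (x : ℕ → Fin 2)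
    (h0 : {n | x n = 0}.Infinite) (h1 : {n | x n = 1}.Infinite) :
    ∃ f : ℤ → ℕ → Fin 2,
      Set.range f = {y | E0 x y} ∧
      ∀ m n : ℤ, m ≤ n ↔ Le0 (f m) (f n) := by
  choose f M hf hv using exists_binaryValue_sub_eq h0 h1
  have le0_iff : ∀ {y z : ℕ → Fin 2} {N K : ℕ}, (∀ n, N ≤ n → y n = x n) →
      (∀ n, K ≤ n → z n = x n) →
      (Le0 y z ↔ binaryValue N y - binaryValue N x ≤ binaryValue K z - binaryValue K x) := by
    intro y z N K hy hz
    rw [← binaryValue_sub_binaryValue (le_max_left N K) hy,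
      ← binaryValue_sub_binaryValue (le_max_right N K) hz, sub_le_sub_iff_right]
    exact le0_iff_binaryValue_le fun n hn =>
      (hy n (le_of_max_le_left hn)).trans (hz n (le_of_max_le_right hn)).symm
  refine ⟨f, Set.Subset.antisymm ?_ fun y hy => ?_, fun m n => ?_⟩
  · rintro _ ⟨m, rfl⟩
    exact e0_iff_exists_forall_ge.2 ⟨M m, hf m⟩
  · obtain ⟨N, hN⟩ := e0_iff_exists_forall_ge.1 hy
    set m := binaryValue N y - binaryValue N x with hm
    refine ⟨m, ?_⟩
    have hsub := binaryValue_sub_binaryValue (le_max_left (M m) N) (hf m)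
    have hsub' := binaryValue_sub_binaryValue (le_max_right (M m) N) hN
    have hvm := hv m
    have h : ∀ n, max (M m) N ≤ n → f m n = y n := fun n hn =>
      (hf m n (le_of_max_le_left hn)).trans (hN n (le_of_max_le_right hn)).symm
    rcases binaryValue_trichotomy h with h | ⟨-, h⟩ | ⟨-, h⟩
    · exact h
    all_goals omega
  · rw [le0_iff (hf m) (hf n), hv, hv]
end

section
/- Let E be an equivalence relation on a set T, let n ≥ 1, and for each binary string u ∈ 2^n let X_u ⊆ T be a nonempty set. Suppose that for every crucial pair ⟨u,v⟩ in 2^n there is a set Q_{uv} ⊆ T × T such that x E y for every (x,y) ∈ Q_{uv}, the first projection (domain) of Q_{uv} equals X_u, and the second projection (range) of Q_{uv} equals X_v. Then [X_u]_E = [X_v]_E for all u, v ∈ 2^n. -/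
/-- For binary strings `u, v ∈ 2^n`, the pair `⟨u,v⟩` is crucial iff there are `k < n`
and `w ∈ 2^{n-k-1}` such that `u = 1^k⌢0⌢w` and `v = 0^k⌢1⌢w`. -/
def Crucial (n : ℕ) (u v : Fin n → Fin 2) : Prop :=
  ∃ k, k < n ∧
    (∀ i : Fin n, (i : ℕ) < k → u i = 1 ∧ v i = 0) ∧
    (∀ i : Fin n, (i : ℕ) = k → u i = 0 ∧ v i = 1) ∧
    (∀ i : Fin n, k < (i : ℕ) → u i = v i)

/-- The `E`-saturation `[X]_E = {y : ∃ x ∈ X, x E y}` of a set `X`. -/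
def satE {T : Type*} (E : T → T → Prop) (X : Set T) : Set T := {y | ∃ x ∈ X, E x y}

/-- Appending a common last digit to a crucial pair gives a crucial pair. -/
theorem Crucial.snoc {n : ℕ} {u v : Fin n → Fin 2} (h : Crucial n u v) (b : Fin 2) :
    Crucial (n + 1) (Fin.snoc u b) (Fin.snoc v b) := by
  obtain ⟨k, hk, h_lt, h_eq, h_gt⟩ := h
  refine ⟨k, by omega, fun i => ?_, fun i => ?_, fun i => ?_⟩
  · cases i using Fin.lastCases with
    | last => intro hi; simp at hi; omega
    | cast i => simpa using h_lt i
  · cases i using Fin.lastCases with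
    | last => intro hi; simp at hi; omega
    | cast i => simpa using h_eq i
  · cases i using Fin.lastCases with
    | last => simp
    | cast i => simpa using h_gt i

/-- The strings `1^n⌢0` and `0^n⌢1` form a crucial pair. -/
theorem crucial_snoc_one_zero (n : ℕ) :
    Crucial (n + 1) (Fin.snoc (fun _ : Fin n => (1 : Fin 2)) 0)
      (Fin.snoc (fun _ : Fin n => (0 : Fin 2)) 1) := by
  refine ⟨n, by omega, fun i => ?_, fun i => ?_, fun i hi => by omega⟩
  · cases i using Fin.lastCases with
    | last => simp
    | cast i => simp
  · cases i using Fin.lastCases with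
    | last => simp
    | cast i => intro hi; simp at hi; omega

/-- The crucial pairs connect `2^n`: a function which agrees on each crucial pair is constant. -/
theorem eq_of_forall_crucial_eq {α : Type*} {n : ℕ} (f : (Fin n → Fin 2) → α)
    (hf : ∀ u v, Crucial n u v → f u = f v) (u v : Fin n → Fin 2) : f u = f v := by
  induction n with
  | zero => rw [Subsingleton.elim u v]
  | succ n ih =>
    have same_last (b : Fin 2) (s t : Fin n → Fin 2) :
        f (Fin.snoc s b) = f (Fin.snoc t b) :=
      ih (fun s => f (Fin.snoc s b)) (fun s t h => hf _ _ (h.snoc b)) s t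
    have eq_base (s : Fin n → Fin 2) (b : Fin 2) :
        f (Fin.snoc s b) = f (Fin.snoc (fun _ : Fin n => (0 : Fin 2)) 1) := by
      obtain rfl | rfl : b = 0 ∨ b = 1 := by omega
      · exact (same_last 0 s _).trans (hf _ _ (crucial_snoc_one_zero n))
      · exact same_last 1 s _
    rw [← Fin.snoc_init_self u, ← Fin.snoc_init_self v]
    exact (eq_base _ _).trans (eq_base _ _).symm

/-- The two projections of a set of `E`-equivalent pairs have the same saturation. -/
theorem satE_image_fst_eq_satE_image_snd {T : Type*} {E : T → T → Prop} (hE : Equivalence E)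
    {Q : Set (T × T)} (hQ : ∀ p ∈ Q, E p.1 p.2) :
    satE E (Prod.fst '' Q) = satE E (Prod.snd '' Q) := by
  ext y
  constructor
  · rintro ⟨_, ⟨p, hp, rfl⟩, h⟩
    exact ⟨p.2, ⟨p, hp, rfl⟩, hE.trans (hE.symm (hQ p hp)) h⟩
  · rintro ⟨_, ⟨p, hp, rfl⟩, h⟩
    exact ⟨p.1, ⟨p, hp, rfl⟩, hE.trans (hQ p hp) h⟩

/-- Let `E` be an equivalence relation on `T`, `n ≥ 1`, and for each `u ∈ 2^n` let
`X u ⊆ T` be nonempty. Suppose for every crucial pair `⟨u,v⟩` in `2^n` there is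
`Q ⊆ T × T` consisting of `E`-equivalent pairs whose first projection is `X u` and
whose second projection is `X v`. Then `[X u]_E = [X v]_E` for all `u, v ∈ 2^n`. -/
theorem saturations_equal_along_crucial_pairs {T : Type*} (E : T → T → Prop)
    (hE : Equivalence E) (n : ℕ) (hn : 1 ≤ n)
    (X : (Fin n → Fin 2) → Set T) (hne : ∀ u, (X u).Nonempty)
    (hQ : ∀ u v, Crucial n u v → ∃ Q : Set (T × T),
      (∀ p ∈ Q, E p.1 p.2) ∧ Prod.fst '' Q = X u ∧ Prod.snd '' Q = X v) :
    ∀ u v, satE E (X u) = satE E (X v) := by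
  refine eq_of_forall_crucial_eq (fun u => satE E (X u)) fun u v h => ?_
  obtain ⟨Q, hQE, hu, hv⟩ := hQ u v h
  simpa only [hu, hv] using satE_image_fst_eq_satE_image_snd hE hQE
end

section
/- Let ≼ be a quasi-order (reflexive and transitive relation) on a set T, let A be an antichain of binary strings of ordinal length, and let F : T → A satisfy: x ≼ y implies F(x) ≤lex F(y). Let X' ⊆ T be such that whenever F(x) = F(x'), x' ≼ x, and x ∈ X', then x' ∈ X'. Define G : T → binary strings by G(x) = F(x)⌢0 if x ∈ X' and G(x) = F(x)⌢1 otherwise (appending one bit at the end). Then the range of G is an antichain, x ≼ y implies G(x) ≤lex G(y), and G(x) ≠ G(y) whenever x ∈ X' and y ∉ X'. -/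
/-- A binary string of ordinal length: a function `s : β → {0,1}` where `β` is an ordinal. -/
structure OrdStr where
  len : Ordinal
  val : ∀ ξ : Ordinal, ξ < len → Fin 2

/-- `t` extends `s` (`s ⊑ t`): `s` equals the restriction of `t` to the domain of `s`. -/
def StrExt (s t : OrdStr) : Prop :=
  ∃ h : s.len ≤ t.len, ∀ ξ (hξ : ξ < s.len), s.val ξ hξ = t.val ξ (lt_of_lt_of_le hξ h)

/-- Strict lexicographic order: there is `ξ` in both domains with `s↾ξ = t↾ξ`,
`s(ξ) = 0` and `t(ξ) = 1`. -/
def StrLexLt (s t : OrdStr) : Prop :=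
  ∃ (ξ : Ordinal) (hs : ξ < s.len) (ht : ξ < t.len),
    (∀ η (hη : η < ξ), s.val η (hη.trans hs) = t.val η (hη.trans ht)) ∧
    s.val ξ hs = 0 ∧ t.val ξ ht = 1

/-- Non-strict lexicographic order. -/
def StrLexLe (s t : OrdStr) : Prop := s = t ∨ StrLexLt s t

/-- A set of binary strings of ordinal length is an antichain iff its elements are
pairwise incomparable under the extension relation. -/
def IsAntichainStr (A : Set OrdStr) : Prop :=
  ∀ s ∈ A, ∀ t ∈ A, s ≠ t → ¬ StrExt s t ∧ ¬ StrExt t s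

/-- `s⌢i`: the string of length `s.len + 1` extending `s` with last value `i`. -/
noncomputable def strSnoc (s : OrdStr) (i : Fin 2) : OrdStr :=
  ⟨s.len + 1, fun ξ _ => if h : ξ < s.len then s.val ξ h else i⟩

theorem strSnoc_val_lt (s : OrdStr) (i : Fin 2) {ξ : Ordinal} (h : ξ < s.len)
    (h' : ξ < (strSnoc s i).len) : (strSnoc s i).val ξ h' = s.val ξ h :=
  dif_pos h

theorem strSnoc_val_len (s : OrdStr) (i : Fin 2) (h : s.len < (strSnoc s i).len) :
    (strSnoc s i).val s.len h = i :=
  dif_neg (lt_irrefl _)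

theorem lt_strSnoc_len {s : OrdStr} (i : Fin 2) {ξ : Ordinal} (h : ξ < s.len) :
    ξ < (strSnoc s i).len :=
  h.trans (Order.lt_add_one_iff.2 le_rfl)

theorem len_lt_strSnoc_len (s : OrdStr) (i : Fin 2) : s.len < (strSnoc s i).len :=
  Order.lt_add_one_iff.2 le_rfl

theorem StrExt.refl (s : OrdStr) : StrExt s s :=
  ⟨le_rfl, fun _ _ => rfl⟩

theorem StrExt.of_strSnoc {s t : OrdStr} {i j : Fin 2}
    (h : StrExt (strSnoc s i) (strSnoc t j)) : StrExt s t := by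
  obtain ⟨hle, hval⟩ := h
  have hlen : s.len ≤ t.len :=
    Order.lt_add_one_iff.1 (lt_of_lt_of_le (len_lt_strSnoc_len s i) hle)
  refine ⟨hlen, fun ξ hξ => ?_⟩
  have := hval ξ (lt_strSnoc_len i hξ)
  rwa [strSnoc_val_lt s i hξ, strSnoc_val_lt t j (hξ.trans_le hlen)] at this

theorem StrExt.strSnoc_bit_eq {s : OrdStr} {i j : Fin 2}
    (h : StrExt (strSnoc s i) (strSnoc s j)) : i = j := by
  obtain ⟨_, hval⟩ := h
  have := hval s.len (len_lt_strSnoc_len s i)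
  rwa [strSnoc_val_len, strSnoc_val_len] at this

theorem StrLexLt.strSnoc {s t : OrdStr} (h : StrLexLt s t) (i j : Fin 2) :
    StrLexLt (strSnoc s i) (strSnoc t j) := by
  obtain ⟨ξ, hs, ht, heq, h0, h1⟩ := h
  refine ⟨ξ, lt_strSnoc_len i hs, lt_strSnoc_len j ht, fun η hη => ?_, ?_, ?_⟩
  · rw [strSnoc_val_lt s i (hη.trans hs), strSnoc_val_lt t j (hη.trans ht), heq η hη]
  · rw [strSnoc_val_lt s i hs, h0]
  · rw [strSnoc_val_lt t j ht, h1]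

theorem strSnoc_zero_lexLt_one (s : OrdStr) : StrLexLt (strSnoc s 0) (strSnoc s 1) := by
  refine ⟨s.len, len_lt_strSnoc_len s 0, len_lt_strSnoc_len s 1, fun η hη => ?_, ?_, ?_⟩
  · rw [strSnoc_val_lt s 0 hη, strSnoc_val_lt s 1 hη]
  · exact strSnoc_val_len s 0 _
  · exact strSnoc_val_len s 1 _

theorem IsAntichainStr.eq_of_strExt_strSnoc {A : Set OrdStr} (hA : IsAntichainStr A)
    {s t : OrdStr} (hs : s ∈ A) (ht : t ∈ A) {i j : Fin 2}
    (h : StrExt (strSnoc s i) (strSnoc t j)) : s = t ∧ i = j := by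
  obtain rfl : s = t := by
    by_contra hne
    exact (hA s hs t ht hne).1 h.of_strSnoc
  exact ⟨rfl, h.strSnoc_bit_eq⟩

/-- Let `≼` be a quasi-order on `T`, `A` an antichain of binary strings of ordinal
length, and `F : T → A` LR order preserving. Let `X' ⊆ T` be such that whenever
`F x = F x'`, `x' ≼ x` and `x ∈ X'`, then `x' ∈ X'`. Define `G x = F x⌢0` for
`x ∈ X'` and `G x = F x⌢1` otherwise. Then the range of `G` is an antichain, `G` is
LR order preserving, and `G x ≠ G y` whenever `x ∈ X'` and `y ∉ X'`. -/
theorem derived_function_separates {T : Type*} (pre : T → T → Prop)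
    (hrefl : ∀ x, pre x x) (htrans : ∀ x y z, pre x y → pre y z → pre x z)
    (A : Set OrdStr) (hA : IsAntichainStr A)
    (F : T → OrdStr) (hFA : ∀ x, F x ∈ A)
    (hFmono : ∀ x y, pre x y → StrLexLe (F x) (F y))
    (X' : Set T)
    (hX' : ∀ x x', F x = F x' → pre x' x → x ∈ X' → x' ∈ X')
    (G : T → OrdStr)
    (hG0 : ∀ x ∈ X', G x = strSnoc (F x) 0)
    (hG1 : ∀ x ∉ X', G x = strSnoc (F x) 1) :
    (∀ x y, G x ≠ G y → ¬ StrExt (G x) (G y) ∧ ¬ StrExt (G y) (G x)) ∧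
    (∀ x y, pre x y → StrLexLe (G x) (G y)) ∧
    (∀ x y, x ∈ X' → y ∉ X' → G x ≠ G y) := by
  have hG : ∀ x, ∃ i, G x = strSnoc (F x) i := fun x => by
    by_cases hx : x ∈ X'
    · exact ⟨0, hG0 x hx⟩
    · exact ⟨1, hG1 x hx⟩
  have hext : ∀ x y, StrExt (G x) (G y) → G x = G y := fun x y h => by
    obtain ⟨i, hi⟩ := hG x
    obtain ⟨j, hj⟩ := hG y
    rw [hi, hj] at h ⊢
    obtain ⟨hF, rfl⟩ := hA.eq_of_strExt_strSnoc (hFA x) (hFA y) h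
    rw [hF]
  refine ⟨fun x y hne => ⟨fun h => hne (hext x y h), fun h => hne (hext y x h).symm⟩,
    fun x y hxy => ?_, fun x y hx hy h => ?_⟩
  · rcases hFmono x y hxy with hF | hF
    · by_cases hx : x ∈ X'
      · by_cases hy : y ∈ X'
        · exact Or.inl (by rw [hG0 x hx, hG0 y hy, hF])
        · rw [hG0 x hx, hG1 y hy, hF]
          exact Or.inr (strSnoc_zero_lexLt_one _)
      · have hy : y ∉ X' := fun hy => hx (hX' y x hF.symm hxy hy)
        exact Or.inl (by rw [hG1 x hx, hG1 y hy, hF])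
    · obtain ⟨i, hi⟩ := hG x
      obtain ⟨j, hj⟩ := hG y
      rw [hi, hj]
      exact Or.inr (hF.strSnoc i j)
  · have h' : StrExt (strSnoc (F x) 0) (strSnoc (F y) 1) := by
      rw [← hG0 x hx, ← hG1 y hy, h]
      exact StrExt.refl _
    exact absurd (hA.eq_of_strExt_strSnoc (hFA x) (hFA y) h').2 (by decide)
end
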